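/- arXiv:2304.14890 — 3 statements merged into one kernel-verified Lean document; each statement's English description precedes it below -/
import Mathlib

section
/- Let E ≥ 1 and let μ be the Haar probability measure on the group O(E) of E×E real orthogonal matrices. For all indices i, j, a, b in {1,…,E}, the integral ∫ O_{i a} · O_{j b} dμ(O) equals 1/E if i = j and a = b, and equals 0 otherwise. -/
open Matrix MeasureTheory

/-- The (Borel) measurable structure on real matrices, entrywise. -/
instance matrixMeasurableSpace (m n : Type*) : MeasurableSpace (Matrix m n ℝ) :=
  inferInstanceAs (MeasurableSpace (m → n → ℝ))

theorem integral_comp_eq_of_map_eq {α : Type*} [MeasurableSpace α] {μ : Measure α} {φ : α → α}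
    (hφ : Measurable φ) (hmap : Measure.map φ μ = μ) {g : α → ℝ} (hg : Measurable g) :
    ∫ x, g (φ x) ∂μ = ∫ x, g x ∂μ := by
  conv_rhs => rw [← hmap]
  exact (integral_map hφ.aemeasurable hg.aestronglyMeasurable).symm

theorem measurable_matrix_entry {m n : Type*} (i : m) (a : n) :
    Measurable (fun O : Matrix m n ℝ => O i a) :=
  (measurable_pi_apply a).comp (measurable_pi_apply (X := fun _ : m => n → ℝ) i)

theorem measurable_matrix_of_entries {α m n : Type*} [MeasurableSpace α] {φ : α → Matrix m n ℝ}
    (h : ∀ i a, Measurable fun x => φ x i a) : Measurable φ :=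
  measurable_pi_iff.2 fun i => measurable_pi_iff.2 fun a => h i a

theorem measurable_matrix_entry_mul {m n : Type*} (i j : m) (a b : n) :
    Measurable (fun O : Matrix m n ℝ => O i a * O j b) :=
  (measurable_matrix_entry i a).mul (measurable_matrix_entry j b)

section OrthogonalMoments

variable {n : Type*} [Fintype n]

theorem measurable_const_matrix_mul (Q : Matrix n n ℝ) :
    Measurable (fun O : Matrix n n ℝ => Q * O) :=
  measurable_matrix_of_entries fun _ a => by
    simp only [Matrix.mul_apply]
    exact Finset.measurable_sum _ fun k _ => (measurable_matrix_entry k a).const_mul _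

theorem measurable_matrix_mul_const (Q : Matrix n n ℝ) :
    Measurable (fun O : Matrix n n ℝ => O * Q) :=
  measurable_matrix_of_entries fun i _ => by
    simp only [Matrix.mul_apply]
    exact Finset.measurable_sum _ fun k _ => (measurable_matrix_entry i k).mul_const _

variable [DecidableEq n]

/-- The reflection negating the `i`-th coordinate. -/
def coordReflection (i : n) : Matrix n n ℝ :=
  diagonal fun k => if k = i then -1 else 1

theorem coordReflection_transpose_mul_self (i : n) :
    (coordReflection i)ᵀ * coordReflection i = 1 := by
  rw [coordReflection, diagonal_transpose, diagonal_mul_diagonal, ← diagonal_one]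
  congr 1
  ext k
  split_ifs <;> norm_num

theorem permMatrix_transpose_mul_self (σ : Equiv.Perm n) :
    (σ.permMatrix ℝ)ᵀ * σ.permMatrix ℝ = 1 := by
  rw [transpose_permMatrix, ← permMatrix_mul, mul_inv_cancel, permMatrix_one]

variable {μ : Measure (Matrix n n ℝ)}

theorem integral_entry_mul_eq_zero_of_row_ne
    (hinv : ∀ Q : Matrix n n ℝ, Qᵀ * Q = 1 → Measure.map (fun O => Q * O) μ = μ)
    {i j : n} (hij : i ≠ j) (a b : n) : ∫ O, O i a * O j b ∂μ = 0 := by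
  have h := integral_comp_eq_of_map_eq (measurable_const_matrix_mul (coordReflection i))
    (hinv _ (coordReflection_transpose_mul_self i)) (measurable_matrix_entry_mul i j a b)
  simp only [coordReflection, diagonal_mul, if_true, if_neg hij.symm, neg_mul, one_mul,
    integral_neg] at h
  linarith

theorem integral_entry_mul_eq_zero_of_col_ne
    (hinv : ∀ Q : Matrix n n ℝ, Qᵀ * Q = 1 → Measure.map (fun O => O * Q) μ = μ)
    (i j : n) {a b : n} (hab : a ≠ b) : ∫ O, O i a * O j b ∂μ = 0 := by
  have h := integral_comp_eq_of_map_eq (measurable_matrix_mul_const (coordReflection a))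
    (hinv _ (coordReflection_transpose_mul_self a)) (measurable_matrix_entry_mul i j a b)
  simp only [coordReflection, mul_diagonal, if_true, if_neg hab.symm, mul_neg, neg_mul, mul_one,
    integral_neg] at h
  linarith

theorem integral_entry_mul_self_eq_of_row
    (hinv : ∀ Q : Matrix n n ℝ, Qᵀ * Q = 1 → Measure.map (fun O => Q * O) μ = μ)
    (i k a : n) : ∫ O, O k a * O k a ∂μ = ∫ O, O i a * O i a ∂μ := by
  have h := integral_comp_eq_of_map_eq
    (measurable_const_matrix_mul ((Equiv.swap i k).permMatrix ℝ))
    (hinv _ (permMatrix_transpose_mul_self _)) (measurable_matrix_entry_mul i i a a)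
  simpa [Equiv.Perm.permMatrix, PEquiv.toMatrix_toPEquiv_mul] using h

theorem sum_entry_mul_self_col {O : Matrix n n ℝ} (hO : Oᵀ * O = 1) (a : n) :
    ∑ k, O k a * O k a = 1 := by
  simpa [Matrix.mul_apply] using congrFun (congrFun hO a) a

theorem integrable_entry_mul_self [IsFiniteMeasure μ] (hμ : ∀ᵐ O ∂μ, Oᵀ * O = 1) (i a : n) :
    Integrable (fun O : Matrix n n ℝ => O i a * O i a) μ := by
  refine Integrable.of_bound (measurable_matrix_entry_mul i i a a).aestronglyMeasurable 1 ?_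
  filter_upwards [hμ] with O hO
  rw [Real.norm_of_nonneg (mul_self_nonneg _), ← sum_entry_mul_self_col hO a]
  exact Finset.single_le_sum (f := fun k => O k a * O k a) (fun k _ => mul_self_nonneg _)
    (Finset.mem_univ i)

theorem integral_entry_mul_self [IsProbabilityMeasure μ] (hμ : ∀ᵐ O ∂μ, Oᵀ * O = 1)
    (hinv : ∀ Q : Matrix n n ℝ, Qᵀ * Q = 1 → Measure.map (fun O => Q * O) μ = μ)
    (i a : n) : ∫ O, O i a * O i a ∂μ = 1 / (Fintype.card n : ℝ) := by
  have hsum : ∑ k, ∫ O, O k a * O k a ∂μ = 1 := by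
    rw [← integral_finsetSum _ fun k _ => integrable_entry_mul_self hμ k a,
      integral_congr_ae (hμ.mono fun O hO => sum_entry_mul_self_col hO a)]
    simp
  simp only [integral_entry_mul_self_eq_of_row hinv i, Finset.sum_const, Finset.card_univ,
    nsmul_eq_mul] at hsum
  exact eq_one_div_of_mul_eq_one_right hsum

end OrthogonalMoments

/-- `k = 1` orthogonal Weingarten formula: for the Haar probability measure on `O(E)`,
`∫ O_{ia} O_{jb} dμ(O) = δ_{ij} δ_{ab} / E`. The Haar measure is characterized as a
probability measure supported on the orthogonal matrices and invariant under left
and right translation by them. -/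
theorem stmt_4 (E : ℕ) (hE : 1 ≤ E)
    (μ : Measure (Matrix (Fin E) (Fin E) ℝ)) [IsProbabilityMeasure μ]
    (hsupp : ∀ᵐ O ∂μ, Oᵀ * O = 1 ∧ O * Oᵀ = 1)
    (hinvL : ∀ Q : Matrix (Fin E) (Fin E) ℝ, Qᵀ * Q = 1 →
      Measure.map (fun O => Q * O) μ = μ)
    (hinvR : ∀ Q : Matrix (Fin E) (Fin E) ℝ, Qᵀ * Q = 1 →
      Measure.map (fun O => O * Q) μ = μ)
    (i j a b : Fin E) :
    ∫ O, O i a * O j b ∂μ = if i = j ∧ a = b then 1 / (E : ℝ) else 0 := by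
  split_ifs with h
  · obtain ⟨rfl, rfl⟩ := h
    simpa using integral_entry_mul_self (hsupp.mono fun _ hO => hO.1) hinvL i a
  · by_cases hij : i = j
    · exact integral_entry_mul_eq_zero_of_col_ne hinvR i j fun hab => h ⟨hij, hab⟩
    · exact integral_entry_mul_eq_zero_of_row_ne hinvL hij a b
end

section
/- Let E ≥ 1, let μ be the Haar probability measure on O(E), let Ω be a real symmetric E×E matrix with Ω² = Ω and Tr(Ω) = L, and let s ∈ ℝᴱ. Then ∫ ‖(Oᵗ Ω O) s − (L/E) s‖² dμ(O) = (L/E)(1 − L/E) ‖s‖², where ‖·‖ is the Euclidean norm on ℝᴱ. -/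
open Matrix MeasureTheory

section HaarSecondMoment

variable {E : ℕ}

theorem measurable_matrix_entry_s6 (i j : Fin E) :
    Measurable (fun O : Matrix (Fin E) (Fin E) ℝ => O i j) :=
  (measurable_pi_apply j).comp (measurable_pi_apply (X := fun _ : Fin E => Fin E → ℝ) i)

theorem measurable_mulVec_apply (s : Fin E → ℝ) (a : Fin E) :
    Measurable (fun O : Matrix (Fin E) (Fin E) ℝ => (O *ᵥ s) a) := by
  simp only [mulVec, dotProduct]
  exact Finset.measurable_sum _ fun j _ => (measurable_matrix_entry_s6 a j).mul_const (s j)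

theorem measurable_const_mul_matrix (Q : Matrix (Fin E) (Fin E) ℝ) :
    Measurable (fun O : Matrix (Fin E) (Fin E) ℝ => Q * O) := by
  refine measurable_pi_iff.2 fun i => measurable_pi_iff.2 fun j => ?_
  simp only [mul_apply]
  exact Finset.measurable_sum _ fun k _ => (measurable_matrix_entry_s6 k j).const_mul (Q i k)

theorem dotProduct_mulVec_self_of_orthogonal {O : Matrix (Fin E) (Fin E) ℝ}
    (hO : Oᵀ * O = 1) (s : Fin E → ℝ) : (O *ᵥ s) ⬝ᵥ (O *ᵥ s) = s ⬝ᵥ s := by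
  rw [dotProduct_mulVec, vecMul_mulVec, ← dotProduct_mulVec, hO, one_mulVec]

theorem abs_mulVec_mul_mulVec_le {O : Matrix (Fin E) (Fin E) ℝ}
    (hO : Oᵀ * O = 1) (s : Fin E → ℝ) (a b : Fin E) :
    |(O *ᵥ s) a * (O *ᵥ s) b| ≤ s ⬝ᵥ s := by
  have key : ∀ c, (O *ᵥ s) c ^ 2 ≤ s ⬝ᵥ s := fun c => by
    rw [← dotProduct_mulVec_self_of_orthogonal hO s, sq]
    exact Finset.single_le_sum (f := fun c => (O *ᵥ s) c * (O *ᵥ s) c)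
      (fun i _ => mul_self_nonneg _) (Finset.mem_univ c)
  have ha := key a
  have hb := key b
  rw [abs_le]
  constructor <;> nlinarith [sq_nonneg ((O *ᵥ s) a + (O *ᵥ s) b),
    sq_nonneg ((O *ᵥ s) a - (O *ᵥ s) b)]

variable {μ : Measure (Matrix (Fin E) (Fin E) ℝ)}

theorem integrable_mulVec_mul_mulVec [IsProbabilityMeasure μ]
    (hsupp : ∀ᵐ O ∂μ, Oᵀ * O = 1) (s : Fin E → ℝ) (a b : Fin E) :
    Integrable (fun O => (O *ᵥ s) a * (O *ᵥ s) b) μ := by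
  refine Integrable.of_bound (C := s ⬝ᵥ s)
    ((measurable_mulVec_apply s a).mul (measurable_mulVec_apply s b)).aestronglyMeasurable ?_
  filter_upwards [hsupp] with O hO
  exact abs_mulVec_mul_mulVec_le hO s a b

theorem integral_mulVec_mul_mulVec_left_invariant {Q : Matrix (Fin E) (Fin E) ℝ}
    (hQ : Measure.map (fun O => Q * O) μ = μ) (s : Fin E → ℝ) (a b : Fin E) :
    ∫ O, (O *ᵥ s) a * (O *ᵥ s) b ∂μ
      = ∫ O, (Q *ᵥ (O *ᵥ s)) a * (Q *ᵥ (O *ᵥ s)) b ∂μ := by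
  conv_lhs => rw [← hQ]
  rw [integral_map (f := fun O => (O *ᵥ s) a * (O *ᵥ s) b)
    (measurable_const_mul_matrix Q).aemeasurable
    ((measurable_mulVec_apply s a).mul (measurable_mulVec_apply s b)).aestronglyMeasurable]
  simp only [mulVec_mulVec]

theorem integral_mulVec_mul_mulVec_of_ne
    (hinv : ∀ Q : Matrix (Fin E) (Fin E) ℝ, Qᵀ * Q = 1 → Measure.map (fun O => Q * O) μ = μ)
    (s : Fin E → ℝ) {a b : Fin E} (hab : a ≠ b) :
    ∫ O, (O *ᵥ s) a * (O *ᵥ s) b ∂μ = 0 := by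
  have hQ : (diagonal fun i : Fin E => if i = a then (-1 : ℝ) else 1)ᵀ *
      (diagonal fun i : Fin E => if i = a then (-1 : ℝ) else 1) = 1 := by
    rw [diagonal_transpose, diagonal_mul_diagonal, ← diagonal_one]
    congr 1
    ext i
    split_ifs <;> norm_num
  have h := integral_mulVec_mul_mulVec_left_invariant (hinv _ hQ) s a b
  simp only [mulVec_diagonal, if_true, if_neg hab.symm, one_mul, neg_mul, integral_neg] at h
  linarith

theorem integral_mulVec_sq_eq
    (hinv : ∀ Q : Matrix (Fin E) (Fin E) ℝ, Qᵀ * Q = 1 → Measure.map (fun O => Q * O) μ = μ)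
    (s : Fin E → ℝ) (a b : Fin E) :
    ∫ O, (O *ᵥ s) a * (O *ᵥ s) a ∂μ = ∫ O, (O *ᵥ s) b * (O *ᵥ s) b ∂μ := by
  have hQ : ((Equiv.swap a b).permMatrix ℝ)ᵀ * (Equiv.swap a b).permMatrix ℝ = 1 := by
    rw [transpose_permMatrix, ← permMatrix_mul]
    simp
  have h := integral_mulVec_mul_mulVec_left_invariant (hinv _ hQ) s a a
  simpa only [permMatrix_mulVec, Function.comp_apply, Equiv.swap_apply_left] using h

/-- The second moments of `O *ᵥ s` are those of an isotropic vector. -/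
theorem integral_mulVec_mul_mulVec [IsProbabilityMeasure μ]
    (hsupp : ∀ᵐ O ∂μ, Oᵀ * O = 1)
    (hinv : ∀ Q : Matrix (Fin E) (Fin E) ℝ, Qᵀ * Q = 1 → Measure.map (fun O => Q * O) μ = μ)
    (s : Fin E → ℝ) (a b : Fin E) :
    ∫ O, (O *ᵥ s) a * (O *ᵥ s) b ∂μ = if a = b then (s ⬝ᵥ s) / E else 0 := by
  split_ifs with hab
  · subst hab
    have hE : (E : ℝ) ≠ 0 := Nat.cast_ne_zero.2 (Fin.pos a).ne'
    have hsum : ∑ c, ∫ O, (O *ᵥ s) c * (O *ᵥ s) c ∂μ = s ⬝ᵥ s := by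
      rw [← integral_finsetSum _ fun c _ => integrable_mulVec_mul_mulVec hsupp s c c]
      rw [integral_congr_ae (g := fun _ => s ⬝ᵥ s)]
      · simp
      · filter_upwards [hsupp] with O hO
        exact dotProduct_mulVec_self_of_orthogonal hO s
    rw [Finset.sum_congr rfl fun c _ => integral_mulVec_sq_eq hinv s c a] at hsum
    rw [eq_div_iff hE, ← hsum]
    simp [mul_comm]
  · exact integral_mulVec_mul_mulVec_of_ne hinv s hab

theorem integrable_and_integral_quadraticForm [IsProbabilityMeasure μ]
    (hsupp : ∀ᵐ O ∂μ, Oᵀ * O = 1)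
    (hinv : ∀ Q : Matrix (Fin E) (Fin E) ℝ, Qᵀ * Q = 1 → Measure.map (fun O => Q * O) μ = μ)
    (A : Matrix (Fin E) (Fin E) ℝ) (s : Fin E → ℝ) :
    Integrable (fun O => (O *ᵥ s) ⬝ᵥ (A *ᵥ (O *ᵥ s))) μ ∧
      ∫ O, (O *ᵥ s) ⬝ᵥ (A *ᵥ (O *ᵥ s)) ∂μ = A.trace / E * (s ⬝ᵥ s) := by
  have hexp : (fun O : Matrix (Fin E) (Fin E) ℝ => (O *ᵥ s) ⬝ᵥ (A *ᵥ (O *ᵥ s)))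
      = fun O => ∑ a, ∑ b, A a b * ((O *ᵥ s) a * (O *ᵥ s) b) := by
    funext O
    rw [dotProduct]
    refine Finset.sum_congr rfl fun a _ => ?_
    rw [show (A *ᵥ (O *ᵥ s)) a = ∑ b, A a b * (O *ᵥ s) b from rfl, Finset.mul_sum]
    exact Finset.sum_congr rfl fun b _ => by ring
  have hint : ∀ a b, Integrable
      (fun O : Matrix (Fin E) (Fin E) ℝ => A a b * ((O *ᵥ s) a * (O *ᵥ s) b)) μ :=
    fun a b => (integrable_mulVec_mul_mulVec hsupp s a b).const_mul _
  have hint' := fun a => integrable_finsetSum Finset.univ fun b _ => hint a b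
  rw [hexp]
  refine ⟨integrable_finsetSum _ fun a _ => hint' a, ?_⟩
  rw [integral_finsetSum _ fun a _ => hint' a]
  simp_rw [integral_finsetSum _ fun b _ => hint _ b, integral_const_mul,
    integral_mulVec_mul_mulVec hsupp hinv s]
  simp only [mul_ite, mul_zero, Finset.sum_ite_eq, Finset.mem_univ, if_true, trace, diag_apply,
    ← Finset.sum_mul]
  ring

end HaarSecondMoment

theorem sum_sq_projector_sub {n : Type*} [Fintype n] {P : Matrix n n ℝ} (hsymm : P.IsSymm)
    (hproj : P * P = P) (c : ℝ) (s : n → ℝ) :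
    ∑ i, ((P *ᵥ s) i - c * s i) ^ 2
      = (1 - 2 * c) * (s ⬝ᵥ (P *ᵥ s)) + c ^ 2 * (s ⬝ᵥ s) := by
  have h : (P *ᵥ s) ⬝ᵥ (P *ᵥ s) = s ⬝ᵥ (P *ᵥ s) := by
    rw [dotProduct_mulVec, vecMul_mulVec, ← dotProduct_mulVec, hsymm.eq, hproj]
  have hexp : ∑ i, ((P *ᵥ s) i - c * s i) ^ 2
      = (P *ᵥ s) ⬝ᵥ (P *ᵥ s) - 2 * c * (s ⬝ᵥ (P *ᵥ s)) + c ^ 2 * (s ⬝ᵥ s) := by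
    simp only [dotProduct, Finset.mul_sum, ← Finset.sum_sub_distrib, ← Finset.sum_add_distrib]
    exact Finset.sum_congr rfl fun i _ => by ring
  rw [hexp, h]
  ring

/-- Haar-averaged variance of the current: for a projector `Ω` with `Tr Ω = L`,
`∫ ‖(Oᵀ Ω O) s − (L/E) s‖² dμ(O) = (L/E)(1 − L/E)‖s‖²`, where `‖·‖` is the
Euclidean norm (squared norms written as sums of squares of the components). -/
theorem stmt_6 (E : ℕ) (hE : 1 ≤ E)
    (μ : Measure (Matrix (Fin E) (Fin E) ℝ)) [IsProbabilityMeasure μ]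
    (hsupp : ∀ᵐ O ∂μ, Oᵀ * O = 1 ∧ O * Oᵀ = 1)
    (hinvL : ∀ Q : Matrix (Fin E) (Fin E) ℝ, Qᵀ * Q = 1 →
      Measure.map (fun O => Q * O) μ = μ)
    (hinvR : ∀ Q : Matrix (Fin E) (Fin E) ℝ, Qᵀ * Q = 1 →
      Measure.map (fun O => O * Q) μ = μ)
    (Ω : Matrix (Fin E) (Fin E) ℝ) (hΩsymm : Ω.IsSymm) (hΩproj : Ω * Ω = Ω)
    (L : ℝ) (hL : Ω.trace = L)
    (s : Fin E → ℝ) :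
    ∫ O, (∑ i, ((Oᵀ * Ω * O).mulVec s i - (L / E) * s i) ^ 2) ∂μ
      = (L / E) * (1 - L / E) * ∑ i, (s i) ^ 2 := by
  have hsupp' : ∀ᵐ O ∂μ, Oᵀ * O = 1 := hsupp.mono fun O hO => hO.1
  obtain ⟨hint, hval⟩ := integrable_and_integral_quadraticForm hsupp' hinvL Ω s
  have hss : ∑ i, (s i) ^ 2 = s ⬝ᵥ s := Finset.sum_congr rfl fun i _ => sq (s i)
  rw [integral_congr_ae (g := fun O =>
    (1 - 2 * (L / E)) * ((O *ᵥ s) ⬝ᵥ (Ω *ᵥ (O *ᵥ s))) + (L / E) ^ 2 * (s ⬝ᵥ s))]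
  · rw [integral_add (hint.const_mul _) (integrable_const _), integral_const_mul, hval, hL, hss]
    simp only [integral_const, probReal_univ, one_smul]
    ring
  · filter_upwards [hsupp] with O hO
    have hsymm : (Oᵀ * Ω * O).IsSymm := by
      simp [IsSymm, transpose_mul, hΩsymm.eq, Matrix.mul_assoc]
    have hproj : (Oᵀ * Ω * O) * (Oᵀ * Ω * O) = Oᵀ * Ω * O := by
      calc (Oᵀ * Ω * O) * (Oᵀ * Ω * O) = Oᵀ * (Ω * (O * Oᵀ) * Ω) * O := by
            simp only [Matrix.mul_assoc]
        _ = Oᵀ * Ω * O := by rw [hO.2, Matrix.mul_one, hΩproj]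
    rw [sum_sq_projector_sub hsymm hproj]
    congr 2
    rw [← mulVec_mulVec, ← mulVec_mulVec, dotProduct_mulVec, vecMul_transpose]
end

section
/- Let E ≥ 2, let μ be the Haar probability measure on O(E), and let Ω be a real symmetric E×E matrix. Set T₁ = Tr(Ω), T₂ = Tr(Ω²), C₁ = (E+1)/((E−1)E(E+2)), and C₂ = −1/((E−1)E(E+2)). Then the E²×E² matrix ∫ (Oᵗ Ω O) ⊗ (Oᵗ Ω O) dμ(O) (Kronecker product) equals a·(I ⊗ I) + b·S + b·Π, where a = C₁ T₁² + 2 C₂ T₂, b = (C₁ + C₂) T₂ + C₂ T₁², S is the swap matrix with entries S_{(i,j),(k,l)} = δ_{i l} δ_{j k}, and Π is the matrix with entries Π_{(i,j),(k,l)} = δ_{i j} δ_{k l}. -/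
open Matrix MeasureTheory Kronecker

/-- Invariance of a 4-tensor under the diagonal action of the orthogonal group. -/
def OrthogonalInvariant {ι : Type*} [Fintype ι] [DecidableEq ι] (F : ι → ι → ι → ι → ℝ) : Prop :=
  ∀ Q : Matrix ι ι ℝ, Qᵀ * Q = 1 → ∀ i k j l,
    F i k j l = ∑ x, ∑ y, ∑ z, ∑ w, Q x i * Q y k * Q z j * Q w l * F x y z w

namespace OrthogonalInvariant

variable {ι : Type*} [Fintype ι] [DecidableEq ι] {F : ι → ι → ι → ι → ℝ}

lemma apply_eq_zero (hF : OrthogonalInvariant F) {i k j l : ι}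
    (hk : i ≠ k) (hj : i ≠ j) (hl : i ≠ l) : F i k j l = 0 := by
  have hQ : (diagonal fun x => if x = i then (-1 : ℝ) else 1)ᵀ *
      (diagonal fun x => if x = i then (-1 : ℝ) else 1) = 1 := by
    rw [diagonal_transpose, diagonal_mul_diagonal, ← diagonal_one]
    congr 1
    ext x
    split_ifs <;> norm_num
  have h := hF _ hQ i k j l
  simp [diagonal_apply, hk.symm, hj.symm, hl.symm] at h
  linarith

lemma apply_perm (hF : OrthogonalInvariant F) (σ : Equiv.Perm ι) (i k j l : ι) :
    F (σ i) (σ k) (σ j) (σ l) = F i k j l := by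
  have hQ : (of fun x y => if x = σ y then (1 : ℝ) else 0)ᵀ *
      (of fun x y => if x = σ y then (1 : ℝ) else 0) = 1 := by
    ext x y
    simp [mul_apply, one_apply, eq_comm]
  have h := hF _ hQ i k j l
  simp at h
  exact h.symm

lemma apply_self (hF : OrthogonalInvariant F) (h₁ : ∀ i k j l, F i k j l = F k i j l)
    (h₂ : ∀ i k j l, F i k j l = F j l i k) {i j : ι} (hij : i ≠ j) :
    F i i i i = F i i j j + 2 * F i j i j := by
  set v : ι → ℝ := fun x => (if x = i then 1 else 0) - 2 * (if x = j then 1 else 0) with hv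
  have hvv : v ⬝ᵥ v = 5 := by
    simp [hv, dotProduct, mul_sub, Finset.sum_sub_distrib, hij, hij.symm]
    norm_num
  have hQ : (1 - (2 / 5 : ℝ) • vecMulVec v v)ᵀ * (1 - (2 / 5 : ℝ) • vecMulVec v v) = 1 := by
    rw [transpose_sub, transpose_smul, transpose_vecMulVec, transpose_one, sub_mul, mul_sub,
      mul_sub, smul_mul_smul_comm, vecMulVec_mul_vecMulVec, hvv]
    ext x y
    simp [vecMulVec_apply]
    ring
  have hcol : ∀ x, (1 - (2 / 5 : ℝ) • vecMulVec v v) x i =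
      3 / 5 * (if x = i then 1 else 0) + 4 / 5 * (if x = j then 1 else 0) := by
    intro x
    simp [vecMulVec_apply, one_apply, hv, hij]
    split_ifs <;> norm_num
  have hjiji : F j i j i = F i j i j := by
    simpa using hF.apply_perm (Equiv.swap i j) i j i j
  have hjjjj : F j j j j = F i i i i := by
    simpa using hF.apply_perm (Equiv.swap i j) i i i i
  have hijji : F i j j i = F i j i j := by rw [h₂, h₁, h₂]
  have hjiij : F j i i j = F i j i j := by rw [h₁]
  have hjjii : F j j i i = F i i j j := h₂ _ _ _ _
  have hiiij : F i i i j = 0 := by rw [h₂, h₁]; exact hF.apply_eq_zero hij.symm hij.symm hij.symm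
  have hiiji : F i i j i = 0 := by rw [h₂]; exact hF.apply_eq_zero hij.symm hij.symm hij.symm
  have hijii : F i j i i = 0 := by rw [h₁]; exact hF.apply_eq_zero hij.symm hij.symm hij.symm
  have hjiii : F j i i i = 0 := hF.apply_eq_zero hij.symm hij.symm hij.symm
  have hjjji : F j j j i = 0 := by rw [h₂, h₁]; exact hF.apply_eq_zero hij hij hij
  have hjjij : F j j i j = 0 := by rw [h₂]; exact hF.apply_eq_zero hij hij hij
  have hjijj : F j i j j = 0 := by rw [h₁]; exact hF.apply_eq_zero hij hij hij
  have hijjj : F i j j j = 0 := hF.apply_eq_zero hij hij hij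
  have h := hF _ hQ i i i i
  simp only [hcol] at h
  simp [mul_add, add_mul, Finset.sum_add_distrib, mul_assoc] at h
  simp only [hjiji, hjjjj, hijji, hjiij, hjjii, hiiij, hiiji, hijii, hjiii, hjjji, hjjij, hjijj,
    hijjj] at h
  linarith

/-- An orthogonally invariant 4-tensor with the symmetries of `M ⊗ M`, `M` symmetric, is a
combination of the three pairings of its indices. -/
theorem exists_eq [Nontrivial ι] (hF : OrthogonalInvariant F)
    (h₁ : ∀ i k j l, F i k j l = F k i j l) (h₂ : ∀ i k j l, F i k j l = F j l i k) :
    ∃ a b : ℝ, ∀ i k j l, F i k j l = a * (if i = k ∧ j = l then 1 else 0) +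
      b * (if i = l ∧ j = k then 1 else 0) + b * (if i = j ∧ k = l then 1 else 0) := by
  obtain ⟨s, t, hst⟩ := exists_pair_ne ι
  have hperm : ∀ i j : ι, i ≠ j → ∃ σ : Equiv.Perm ι, σ s = i ∧ σ t = j := by
    intro i j hij
    have hi : i ≠ Equiv.swap s i t := fun h => hst <| by
      apply (Equiv.swap s i).injective
      rw [Equiv.swap_apply_left]
      exact h
    refine ⟨Equiv.swap (Equiv.swap s i t) j * Equiv.swap s i, ?_, ?_⟩
    · simp [Equiv.swap_apply_of_ne_of_ne hi hij]
    · simp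
  have hα : ∀ i j, i ≠ j → F i i j j = F s s t t := by
    intro i j hij
    obtain ⟨σ, rfl, rfl⟩ := hperm i j hij
    exact hF.apply_perm σ s s t t
  have hβ : ∀ i j, i ≠ j → F i j i j = F s t s t := by
    intro i j hij
    obtain ⟨σ, rfl, rfl⟩ := hperm i j hij
    exact hF.apply_perm σ s t s t
  refine ⟨F s s t t, F s t s t, fun i k j l => ?_⟩
  by_cases hik : i = k
  · subst hik
    by_cases hjl : j = l
    · subst hjl
      by_cases hij : i = j
      · subst hij
        obtain ⟨j, hj⟩ := exists_ne i
        rw [hF.apply_self h₁ h₂ hj.symm, hα _ _ hj.symm, hβ _ _ hj.symm]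
        simp
        ring
      · simp [hij, hα i j hij]
    · have h0 : F i i j l = 0 := by
        rw [h₂]
        by_cases hij : j = i
        · rw [h₁]
          subst hij
          exact hF.apply_eq_zero (Ne.symm hjl) (Ne.symm hjl) (Ne.symm hjl)
        · exact hF.apply_eq_zero hjl hij hij
      rw [h0]
      grind
  · by_cases hij : i = j
    · subst hij
      by_cases hkl : k = l
      · subst hkl
        simp [hik, hβ i k hik]
      · have h0 : F i k i l = 0 := by
          rw [h₁]
          exact hF.apply_eq_zero (Ne.symm hik) (Ne.symm hik) hkl
        rw [h0]
        grind
    · by_cases hil : i = l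
      · subst hil
        by_cases hkj : k = j
        · subst hkj
          have h0 : F i k k i = F s t s t := by rw [h₂, h₁, h₂, hβ i k hik]
          rw [h0]
          simp [hik]
        · have h0 : F i k j i = 0 := by
            rw [h₁]
            exact hF.apply_eq_zero (Ne.symm hik) hkj (Ne.symm hik)
          rw [h0]
          grind
      · rw [hF.apply_eq_zero hik hij hil]
        simp [hik, hij, hil]

end OrthogonalInvariant

lemma sum_sum_eq_trace_sq {n : Type*} [Fintype n] [DecidableEq n] {O : Matrix n n ℝ}
    (hO : O * Oᵀ = 1) (Ω : Matrix n n ℝ) :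
    ∑ i, ∑ j, (Oᵀ * Ω * O) i i * (Oᵀ * Ω * O) j j = Ω.trace ^ 2 := by
  have h : (Oᵀ * Ω * O).trace = Ω.trace := by
    rw [trace_mul_comm, ← Matrix.mul_assoc, hO, Matrix.one_mul]
  rw [← Finset.sum_mul_sum, ← h, sq]
  rfl

lemma sum_sum_eq_trace_mul_self {n : Type*} [Fintype n] [DecidableEq n] {O : Matrix n n ℝ}
    (hO : O * Oᵀ = 1) (Ω : Matrix n n ℝ) :
    ∑ i, ∑ j, (Oᵀ * Ω * O) i j * (Oᵀ * Ω * O) j i = (Ω * Ω).trace := by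
  have h : ((Oᵀ * Ω * O) * (Oᵀ * Ω * O)).trace = (Ω * Ω).trace := by
    rw [show (Oᵀ * Ω * O) * (Oᵀ * Ω * O) = Oᵀ * (Ω * (O * Oᵀ) * Ω * O) by
      simp only [Matrix.mul_assoc], trace_mul_comm, hO, Matrix.mul_one, Matrix.mul_assoc,
      Matrix.mul_assoc, hO, Matrix.mul_one]
  rw [← h]
  simp only [trace, diag_apply, mul_apply (M := Oᵀ * Ω * O)]

lemma measurable_matrix_apply {m n : Type*} (i : m) (j : n) :
    Measurable fun O : Matrix m n ℝ => O i j :=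
  (measurable_pi_apply j).comp (measurable_pi_apply i)

section Twirl

variable {n : Type*} [Fintype n]

lemma measurable_conj_apply (Ω : Matrix n n ℝ) (i k : n) :
    Measurable fun O : Matrix n n ℝ => (Oᵀ * Ω * O) i k := by
  simp only [mul_apply, transpose_apply]
  have := measurable_matrix_apply (m := n) (n := n)
  fun_prop

lemma measurable_mul_right_matrix (Q : Matrix n n ℝ) :
    Measurable fun O : Matrix n n ℝ => O * Q := by
  refine measurable_pi_lambda _ fun i => measurable_pi_lambda _ fun j => ?_
  simp only [mul_apply]
  have := measurable_matrix_apply (m := n) (n := n)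
  fun_prop

lemma conj_mul_right_apply (O Q Ω : Matrix n n ℝ) (i k : n) :
    ((O * Q)ᵀ * Ω * (O * Q)) i k = ∑ x, ∑ y, Q x i * Q y k * (Oᵀ * Ω * O) x y := by
  rw [show (O * Q)ᵀ * Ω * (O * Q) = Qᵀ * ((Oᵀ * Ω * O) * Q) by
    simp only [transpose_mul, Matrix.mul_assoc], mul_apply]
  simp only [mul_apply (M := Oᵀ * Ω * O), transpose_apply, Finset.mul_sum]
  exact Finset.sum_congr rfl fun x _ => Finset.sum_congr rfl fun y _ => by ring

variable [DecidableEq n]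

lemma abs_apply_le_one {O : Matrix n n ℝ} (hO : Oᵀ * O = 1) (i j : n) : |O i j| ≤ 1 := by
  have h : ∑ x, O x j * O x j = 1 := by
    simpa [mul_apply] using congrFun (congrFun hO j) j
  have hle : O i j * O i j ≤ 1 := h ▸ Finset.single_le_sum (f := fun x => O x j * O x j)
    (fun x _ => mul_self_nonneg _) (Finset.mem_univ i)
  exact abs_le_one_iff_mul_self_le_one.mpr hle

lemma abs_conj_apply_le {O : Matrix n n ℝ} (hO : Oᵀ * O = 1) (Ω : Matrix n n ℝ) (i k : n) :
    |(Oᵀ * Ω * O) i k| ≤ ∑ y, ∑ x, |Ω x y| := by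
  simp only [mul_apply, transpose_apply, Finset.sum_mul]
  refine (Finset.abs_sum_le_sum_abs _ _).trans (Finset.sum_le_sum fun y _ => ?_)
  refine (Finset.abs_sum_le_sum_abs _ _).trans (Finset.sum_le_sum fun x _ => ?_)
  rw [abs_mul, abs_mul]
  have h₁ := abs_apply_le_one hO x i
  have h₂ := abs_apply_le_one hO y k
  calc |O x i| * |Ω x y| * |O y k| ≤ 1 * |Ω x y| * 1 := by gcongr
    _ = |Ω x y| := by ring

lemma integrable_conj_mul_conj {μ : Measure (Matrix n n ℝ)} [IsFiniteMeasure μ]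
    (hμ : ∀ᵐ O ∂μ, Oᵀ * O = 1) (Ω : Matrix n n ℝ) (i k j l : n) :
    Integrable (fun O => (Oᵀ * Ω * O) i k * (Oᵀ * Ω * O) j l) μ := by
  refine Integrable.of_bound ((measurable_conj_apply Ω i k).mul
    (measurable_conj_apply Ω j l)).aestronglyMeasurable
    ((∑ y, ∑ x, |Ω x y|) * ∑ y, ∑ x, |Ω x y|) ?_
  filter_upwards [hμ] with O hO
  rw [Real.norm_eq_abs, abs_mul]
  exact mul_le_mul (abs_conj_apply_le hO Ω i k) (abs_conj_apply_le hO Ω j l) (abs_nonneg _)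
    ((abs_nonneg _).trans (abs_conj_apply_le hO Ω i k))

lemma orthogonalInvariant_integral {μ : Measure (Matrix n n ℝ)} [IsFiniteMeasure μ]
    (hμ : ∀ᵐ O ∂μ, Oᵀ * O = 1)
    (hinv : ∀ Q : Matrix n n ℝ, Qᵀ * Q = 1 → Measure.map (fun O => O * Q) μ = μ)
    (Ω : Matrix n n ℝ) :
    OrthogonalInvariant fun i k j l => ∫ O, (Oᵀ * Ω * O) i k * (Oᵀ * Ω * O) j l ∂μ := by
  intro Q hQ i k j l
  have hint := integrable_conj_mul_conj hμ Ω
  calc ∫ O, (Oᵀ * Ω * O) i k * (Oᵀ * Ω * O) j l ∂μ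
      = ∫ O, (Oᵀ * Ω * O) i k * (Oᵀ * Ω * O) j l ∂(Measure.map (fun O => O * Q) μ) := by
        rw [hinv Q hQ]
    _ = ∫ O, ((O * Q)ᵀ * Ω * (O * Q)) i k * ((O * Q)ᵀ * Ω * (O * Q)) j l ∂μ :=
        integral_map (measurable_mul_right_matrix Q).aemeasurable
          ((measurable_conj_apply Ω i k).mul (measurable_conj_apply Ω j l)).aestronglyMeasurable
    _ = ∫ O, ∑ x, ∑ y, ∑ z, ∑ w, Q x i * Q y k * Q z j * Q w l *
          ((Oᵀ * Ω * O) x y * (Oᵀ * Ω * O) z w) ∂μ := by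
        refine integral_congr_ae (.of_forall fun O => ?_)
        simp only [conj_mul_right_apply]
        simp only [Finset.sum_mul]
        simp only [Finset.mul_sum]
        exact Finset.sum_congr rfl fun x _ => Finset.sum_congr rfl fun y _ =>
          Finset.sum_congr rfl fun z _ => Finset.sum_congr rfl fun w _ => by ring
    _ = _ := by
        have h₁ := fun x y z w => (hint x y z w).const_mul (Q x i * Q y k * Q z j * Q w l)
        have h₂ := fun x y z => integrable_finsetSum Finset.univ fun w _ => h₁ x y z w
        have h₃ := fun x y => integrable_finsetSum Finset.univ fun z _ => h₂ x y z
        have h₄ := fun x => integrable_finsetSum Finset.univ fun y _ => h₃ x y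
        rw [integral_finsetSum _ fun x _ => h₄ x]
        refine Finset.sum_congr rfl fun x _ => ?_
        rw [integral_finsetSum _ fun y _ => h₃ x y]
        refine Finset.sum_congr rfl fun y _ => ?_
        rw [integral_finsetSum _ fun z _ => h₂ x y z]
        refine Finset.sum_congr rfl fun z _ => ?_
        rw [integral_finsetSum _ fun w _ => h₁ x y z w]
        exact Finset.sum_congr rfl fun w _ => integral_const_mul _ _

end Twirl

/-- Second-order isospectral twirling via orthogonal Weingarten calculus:
`∫ (Oᵀ Ω O) ⊗ (Oᵀ Ω O) dμ(O) = a (I ⊗ I) + b S + b Π` (entrywise), where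
`a = C₁ T₁² + 2 C₂ T₂`, `b = (C₁+C₂) T₂ + C₂ T₁²`, `T₁ = Tr Ω`, `T₂ = Tr Ω²`,
`C₁ = (E+1)/((E−1)E(E+2))`, `C₂ = −1/((E−1)E(E+2))`, `S` is the swap matrix and
`Π` the Bell-pair matrix. -/
theorem stmt_8 (E : ℕ) (hE : 2 ≤ E)
    (μ : Measure (Matrix (Fin E) (Fin E) ℝ)) [IsProbabilityMeasure μ]
    (hsupp : ∀ᵐ O ∂μ, Oᵀ * O = 1 ∧ O * Oᵀ = 1)
    (hinvL : ∀ Q : Matrix (Fin E) (Fin E) ℝ, Qᵀ * Q = 1 →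
      Measure.map (fun O => Q * O) μ = μ)
    (hinvR : ∀ Q : Matrix (Fin E) (Fin E) ℝ, Qᵀ * Q = 1 →
      Measure.map (fun O => O * Q) μ = μ)
    (Ω : Matrix (Fin E) (Fin E) ℝ) (hΩsymm : Ω.IsSymm)
    (T₁ T₂ C₁ C₂ a b : ℝ)
    (hT₁ : T₁ = Ω.trace) (hT₂ : T₂ = (Ω * Ω).trace)
    (hC₁ : C₁ = ((E : ℝ) + 1) / (((E : ℝ) - 1) * E * ((E : ℝ) + 2)))
    (hC₂ : C₂ = -1 / (((E : ℝ) - 1) * E * ((E : ℝ) + 2)))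
    (ha : a = C₁ * T₁ ^ 2 + 2 * C₂ * T₂)
    (hb : b = (C₁ + C₂) * T₂ + C₂ * T₁ ^ 2)
    (S Pbell : Matrix (Fin E × Fin E) (Fin E × Fin E) ℝ)
    (hS : S = Matrix.of fun p q =>
      if p.1 = q.2 ∧ p.2 = q.1 then (1 : ℝ) else 0)
    (hPbell : Pbell = Matrix.of fun p q =>
      if p.1 = p.2 ∧ q.1 = q.2 then (1 : ℝ) else 0) :
    ∀ p q : Fin E × Fin E,
      ∫ O, ((Oᵀ * Ω * O) ⊗ₖ (Oᵀ * Ω * O)) p q ∂μ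
        = a * (1 : Matrix (Fin E × Fin E) (Fin E × Fin E) ℝ) p q
          + b * S p q + b * Pbell p q := by
  have : Nontrivial (Fin E) := Fin.nontrivial_iff_two_le.mpr hE
  have hμ : ∀ᵐ O ∂μ, Oᵀ * O = 1 := hsupp.mono fun O h => h.1
  have hsym : ∀ (O : Matrix (Fin E) (Fin E) ℝ) i k,
      (Oᵀ * Ω * O) i k = (Oᵀ * Ω * O) k i := fun O i k => by
    have h : (Oᵀ * Ω * O)ᵀ = Oᵀ * Ω * O := by
      rw [transpose_mul, transpose_mul, transpose_transpose, hΩsymm.eq, Matrix.mul_assoc]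
    exact congrFun (congrFun h k) i
  obtain ⟨A, B, hAB⟩ := (orthogonalInvariant_integral hμ hinvR Ω).exists_eq
    (fun i k j l => by simp only [hsym _ i k])
    (fun i k j l => by simp only [mul_comm])
  have hint := integrable_conj_mul_conj hμ Ω
  have hcomm : ∀ x y : Fin E, (x = y ∧ y = x) ↔ x = y := fun x y =>
    ⟨And.left, fun h => ⟨h, h.symm⟩⟩
  have htr₁ : A * E ^ 2 + 2 * B * E = T₁ ^ 2 := by
    have h : ∫ O, ∑ i, ∑ j, (Oᵀ * Ω * O) i i * (Oᵀ * Ω * O) j j ∂μ = T₁ ^ 2 := by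
      rw [integral_congr_ae (hsupp.mono fun O h => sum_sum_eq_trace_sq h.2 Ω), hT₁]
      simp
    rw [← h, integral_finsetSum _ fun i _ => integrable_finsetSum _ fun j _ => hint i i j j]
    simp only [integral_finsetSum _ fun j _ => hint _ _ j j, hAB]
    simp [Finset.sum_add_distrib, hcomm]
    ring
  have htr₂ : A * E + B * E ^ 2 + B * E = T₂ := by
    have h : ∫ O, ∑ i, ∑ j, (Oᵀ * Ω * O) i j * (Oᵀ * Ω * O) j i ∂μ = T₂ := by
      rw [integral_congr_ae (hsupp.mono fun O h => sum_sum_eq_trace_mul_self h.2 Ω), hT₂]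
      simp
    rw [← h, integral_finsetSum _ fun i _ => integrable_finsetSum _ fun j _ => hint i j j i]
    simp only [integral_finsetSum _ fun j _ => hint _ j j _, hAB]
    simp [Finset.sum_add_distrib, hcomm]
    ring
  have hE' : (2 : ℝ) ≤ E := by exact_mod_cast hE
  have h₀ : (E : ℝ) ≠ 0 := by positivity
  have h₁ : (E : ℝ) - 1 ≠ 0 := by linarith
  have h₂ : (E : ℝ) + 2 ≠ 0 := by positivity
  have hA : a = A := by
    rw [ha, hC₁, hC₂, ← htr₁, ← htr₂]
    field_simp
    ring
  have hB : b = B := by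
    rw [hb, hC₁, hC₂, ← htr₁, ← htr₂]
    field_simp
    ring
  rintro ⟨i, j⟩ ⟨k, l⟩
  simp only [kroneckerMap_apply, hAB, hA, hB, hS, hPbell, of_apply, one_apply, Prod.mk.injEq]
end
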